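/- For all f ∈ C^p(A, A^(⊗k)), g ∈ C^q(A, A^(⊗m)), h ∈ C^r(A, A^(⊗l)) with p, q, r ≥ 2 and k, m, l ≥ 2, the three operations ⊢, ⊣, ∪ are pairwise mutually associative: f ⋆ (g ⋆' h) = (f ⋆ g) ⋆' h for every choice of ⋆, ⋆' ∈ {⊢, ⊣, ∪}. -/

import Mathlib

open scoped TensorProduct

noncomputable section

/-- Tuple obtained by concatenating `x` and `y` while multiplying the two adjacent
boundary components: `(x₀,…,x_{a-1}, x_a·y₀, y₁,…,y_b)`. -/
def mergeTuple {A : Type} [Mul A] {a b : ℕ} (x : Fin (a + 1) → A) (y : Fin (b + 1) → A) :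
    Fin (a + b + 1) → A :=
  fun i =>
    if h : i.1 < a then x ⟨i.1, by omega⟩
    else if h' : i.1 = a then x (Fin.last a) * y 0
    else y ⟨i.1 - a, by have := i.2; omega⟩

/-- Plain concatenation of tuples. -/
def appendTuple {A : Type} {a b : ℕ} (x : Fin (a + 1) → A) (y : Fin (b + 1) → A) :
    Fin (a + b + 2) → A :=
  fun i =>
    if h : i.1 ≤ a then x ⟨i.1, by omega⟩
    else y ⟨i.1 - (a + 1), by have := i.2; omega⟩

/-- The tuple `(a₁,…,aᵢ·a_{i+1},…,a_{n+2})` (0-indexed: multiply entries `i` and `i+1`). -/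
def mulArg {A : Type} [Mul A] {n : ℕ} (a : Fin (n + 2) → A) (i : Fin (n + 1)) :
    Fin (n + 1) → A :=
  fun j =>
    if j.1 < i.1 then a ⟨j.1, by have := j.2; omega⟩
    else if j.1 = i.1 then a ⟨j.1, by have := j.2; omega⟩ * a ⟨j.1 + 1, by have := j.2; omega⟩
    else a ⟨j.1 + 1, by have := j.2; omega⟩

/-- The tower `⊕_{m ≥ 1} A^{⊗m}` of tensor powers of `A` (that is, the positive part of
the free product `A_t = A ∗ k[t]`, via `A^{⊗m} ∋ a₁⊗⋯⊗a_m ↔ a₁ t a₂ t ⋯ t a_m`),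
together with:
* pure tensors `τ` and a `model` identification of the degree-`(m+1)` part with
  `A^{⊗(m+1)}`, pinning the object down;
* the concatenation product `conc` and the merge product
  `mrg((x₁⊗⋯⊗x_a), (y₁⊗⋯⊗y_b)) = x₁⊗⋯⊗(x_a·y₁)⊗⋯⊗y_b`;
* insertion operators `headIns`/`tailIns` extending a multilinear map `f` to an operator
  `f^{[i,j]}` consuming the first (resp. last) tensor component together with given
  explicit arguments;
* the operations `⊢`, `⊣`, `∪` on Hochschild cochains `C^p(A, A^{⊗q})` (a cochain being
  a multilinear map `A^p → ⊕_m A^{⊗m}`, with values in a fixed degree), and the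
  Hochschild differential `hoch`, all characterized by their defining formulas. -/
structure TensorTower (k : Type) [Field k] (A : Type) [Ring A] [Algebra k A] : Type 1 where
  U : Type
  [acg : AddCommGroup U]
  [mod : Module k U]
  Tdeg : ℕ → Submodule k U
  grading : DirectSum.IsInternal Tdeg
  Tdeg_zero : Tdeg 0 = ⊥
  τ : ∀ m : ℕ, MultilinearMap k (fun _ : Fin (m + 1) => A) U
  τ_mem : ∀ (m : ℕ) (x : Fin (m + 1) → A), τ m x ∈ Tdeg (m + 1)
  model : ∀ m : ℕ, (TensorPower k (m + 1) A) ≃ₗ[k] (Tdeg (m + 1))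
  model_eq : ∀ (m : ℕ) (x : Fin (m + 1) → A),
    ((model m (PiTensorProduct.tprod k x)) : U) = τ m x
  conc : U →ₗ[k] U →ₗ[k] U
  conc_eq : ∀ {a b : ℕ} (x : Fin (a + 1) → A) (y : Fin (b + 1) → A),
    conc (τ a x) (τ b y) = τ (a + b + 1) (appendTuple x y)
  mrg : U →ₗ[k] U →ₗ[k] U
  mrg_eq : ∀ {a b : ℕ} (x : Fin (a + 1) → A) (y : Fin (b + 1) → A),
    mrg (τ a x) (τ b y) = τ (a + b) (mergeTuple x y)
  headIns : ∀ {p : ℕ},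
    (MultilinearMap k (fun _ : Fin (p + 1) => A) U) → (Fin p → A) → (U →ₗ[k] U)
  headIns_eq : ∀ {p : ℕ} (f : MultilinearMap k (fun _ : Fin (p + 1) => A) U)
      (v : Fin p → A) {N : ℕ} (x : Fin (N + 2) → A),
    headIns f v (τ (N + 1) x) = conc (f (Fin.snoc v (x 0))) (τ N (Fin.tail x))
  headIns_eq_one : ∀ {p : ℕ} (f : MultilinearMap k (fun _ : Fin (p + 1) => A) U)
      (v : Fin p → A) (x : Fin 1 → A),
    headIns f v (τ 0 x) = f (Fin.snoc v (x 0))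
  tailIns : ∀ {q : ℕ},
    (MultilinearMap k (fun _ : Fin (q + 1) => A) U) → (Fin q → A) → (U →ₗ[k] U)
  tailIns_eq : ∀ {q : ℕ} (g : MultilinearMap k (fun _ : Fin (q + 1) => A) U)
      (v : Fin q → A) {N : ℕ} (x : Fin (N + 2) → A),
    tailIns g v (τ (N + 1) x)
      = conc (τ N (Fin.init x)) (g (Fin.cons (x (Fin.last (N + 1))) v))
  tailIns_eq_one : ∀ {q : ℕ} (g : MultilinearMap k (fun _ : Fin (q + 1) => A) U)
      (v : Fin q → A) (x : Fin 1 → A),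
    tailIns g v (τ 0 x) = g (Fin.cons (x 0) v)
  vdash : ∀ {p q : ℕ},
    MultilinearMap k (fun _ : Fin (p + 2) => A) U →
    MultilinearMap k (fun _ : Fin (q + 2) => A) U →
    MultilinearMap k (fun _ : Fin (p + q + 3) => A) U
  vdash_eq : ∀ {p q : ℕ} (f : MultilinearMap k (fun _ : Fin (p + 2) => A) U)
      (g : MultilinearMap k (fun _ : Fin (q + 2) => A) U) (a : Fin (p + q + 3) → A),
    vdash f g a
      = headIns f (fun i : Fin (p + 1) => a ⟨i.1, by have := i.2; omega⟩)
          (g (fun j : Fin (q + 2) => a ⟨p + 1 + j.1, by have := j.2; omega⟩))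
  dashv : ∀ {p q : ℕ},
    MultilinearMap k (fun _ : Fin (p + 2) => A) U →
    MultilinearMap k (fun _ : Fin (q + 2) => A) U →
    MultilinearMap k (fun _ : Fin (p + q + 3) => A) U
  dashv_eq : ∀ {p q : ℕ} (f : MultilinearMap k (fun _ : Fin (p + 2) => A) U)
      (g : MultilinearMap k (fun _ : Fin (q + 2) => A) U) (a : Fin (p + q + 3) → A),
    dashv f g a
      = tailIns g (fun j : Fin (q + 1) => a ⟨p + 2 + j.1, by have := j.2; omega⟩)
          (f (fun i : Fin (p + 2) => a ⟨i.1, by have := i.2; omega⟩))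
  cup : ∀ {p q : ℕ},
    MultilinearMap k (fun _ : Fin (p + 1) => A) U →
    MultilinearMap k (fun _ : Fin (q + 1) => A) U →
    MultilinearMap k (fun _ : Fin (p + q + 2) => A) U
  cup_eq : ∀ {p q : ℕ} (f : MultilinearMap k (fun _ : Fin (p + 1) => A) U)
      (g : MultilinearMap k (fun _ : Fin (q + 1) => A) U) (a : Fin (p + q + 2) → A),
    cup f g a
      = mrg (f (fun i : Fin (p + 1) => a ⟨i.1, by have := i.2; omega⟩))
          (g (fun j : Fin (q + 1) => a ⟨p + 1 + j.1, by have := j.2; omega⟩))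
  hoch : ∀ {n : ℕ},
    MultilinearMap k (fun _ : Fin (n + 1) => A) U →
    MultilinearMap k (fun _ : Fin (n + 2) => A) U
  hoch_eq : ∀ {n : ℕ} (f : MultilinearMap k (fun _ : Fin (n + 1) => A) U)
      (a : Fin (n + 2) → A),
    hoch f a
      = mrg (τ 0 (fun _ => a 0)) (f (Fin.tail a))
        + (∑ i : Fin (n + 1), ((-1 : ℤ) ^ (i.1 + 1)) • f (mulArg a i))
        + ((-1 : ℤ) ^ (n + 2)) • mrg (f (Fin.init a)) (τ 0 (fun _ => a (Fin.last (n + 1))))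

attribute [instance] TensorTower.acg TensorTower.mod

namespace TensorTower

variable {k A : Type} [Field k] [Ring A] [Algebra k A] (T : TensorTower k A)

/-- The operation `f ∨ g = (f ⊢ g) − (f ⊣ g)` on Hochschild cochains. -/
def vee {p q : ℕ} (f : MultilinearMap k (fun _ : Fin (p + 2) => A) T.U)
    (g : MultilinearMap k (fun _ : Fin (q + 2) => A) T.U) :
    MultilinearMap k (fun _ : Fin (p + q + 3) => A) T.U :=
  T.vdash f g - T.dashv f g

end TensorTower

namespace TensorTower

variable {k A : Type} [Field k] [Ring A] [Algebra k A] (T : TensorTower k A)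

/-- The inclusion of `A` as the degree-one part of the tower. -/
def ι (x : A) : T.U := T.τ 0 fun _ => x

variable {T}

theorem tau_congr {m n : ℕ} (hmn : m = n) {x : Fin (m + 1) → A} {y : Fin (n + 1) → A}
    (hxy : ∀ i (h₁ : i < m + 1) (h₂ : i < n + 1), x ⟨i, h₁⟩ = y ⟨i, h₂⟩) :
    T.τ m x = T.τ n y := by
  subst hmn
  exact congrArg _ (funext fun i => hxy i.1 i.2 i.2)

theorem Tdeg_succ_le_span (m : ℕ) :
    T.Tdeg (m + 1) ≤ Submodule.span k (Set.range (T.τ m)) := by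
  intro u hu
  obtain ⟨t, ht⟩ := (T.model m).surjective ⟨u, hu⟩
  have key : ((T.model m t : T.Tdeg (m + 1)) : T.U) ∈
      Submodule.span k (Set.range (T.τ m)) := by
    clear ht
    induction t using PiTensorProduct.induction_on with
    | smul_tprod r x =>
      rw [map_smul, Submodule.coe_smul, T.model_eq]
      exact Submodule.smul_mem _ _ (Submodule.subset_span ⟨x, rfl⟩)
    | add x y hx hy =>
      rw [map_add, Submodule.coe_add]
      exact Submodule.add_mem _ hx hy
  simpa [ht] using key

theorem span_tau_eq_top :
    Submodule.span k (⋃ m, Set.range (T.τ m)) = ⊤ := by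
  rw [eq_top_iff, ← T.grading.submodule_iSup_eq_top]
  refine iSup_le fun m => ?_
  cases m with
  | zero => rw [T.Tdeg_zero]; exact bot_le
  | succ m =>
    exact (Tdeg_succ_le_span m).trans
      (Submodule.span_mono (Set.subset_iUnion (fun m => Set.range (T.τ m)) m))

/-- Linear maps out of the tower agree when they agree on pure tensors. -/
theorem eq_of_tau {V : Type} [AddCommGroup V] [Module k V] {F G : T.U →ₗ[k] V}
    (hFG : ∀ m x, F (T.τ m x) = G (T.τ m x)) (u : T.U) : F u = G u := by
  refine DFunLike.congr_fun (LinearMap.ext_on span_tau_eq_top fun u hu => ?_) u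
  obtain ⟨m, x, rfl⟩ := Set.mem_iUnion.mp hu
  exact hFG m x

/-- Bilinear maps out of the tower agree when they agree on pure tensors. -/
theorem eq_of_tau₂ {V : Type} [AddCommGroup V] [Module k V] {F G : T.U →ₗ[k] T.U →ₗ[k] V}
    (hFG : ∀ m x n y, F (T.τ m x) (T.τ n y) = G (T.τ m x) (T.τ n y)) (u v : T.U) :
    F u v = G u v :=
  DFunLike.congr_fun (eq_of_tau (fun m x => LinearMap.ext (eq_of_tau (hFG m x))) u) v

/-- Trilinear maps out of the tower agree when they agree on pure tensors. -/
theorem eq_of_tau₃ {V : Type} [AddCommGroup V] [Module k V]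
    {F G : T.U →ₗ[k] T.U →ₗ[k] T.U →ₗ[k] V}
    (hFG : ∀ m x n y l z,
      F (T.τ m x) (T.τ n y) (T.τ l z) = G (T.τ m x) (T.τ n y) (T.τ l z)) (u v w : T.U) :
    F u v w = G u v w :=
  DFunLike.congr_fun
    (eq_of_tau₂ (fun m x n y => LinearMap.ext (eq_of_tau (hFG m x n y))) u v) w

/-- Two bilinear products on the tower are mutually associative when they are so on pure
tensors. -/
theorem assoc_of_tau {B C : T.U →ₗ[k] T.U →ₗ[k] T.U}
    (hBC : ∀ m x n y l z, C (B (T.τ m x) (T.τ n y)) (T.τ l z) =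
      B (T.τ m x) (C (T.τ n y) (T.τ l z))) (u v w : T.U) :
    C (B u v) w = B u (C v w) :=
  eq_of_tau₃ (F := B.compr₂ C)
    (G := (LinearMap.lcomp k (T.U →ₗ[k] T.U) C).comp
      ((LinearMap.llcomp k T.U T.U T.U).comp B)) hBC u v w

theorem conc_assoc (u v w : T.U) : T.conc (T.conc u v) w = T.conc u (T.conc v w) := by
  refine assoc_of_tau (fun m x n y l z => ?_) u v w
  simp only [T.conc_eq]
  refine tau_congr (by omega) fun i h₁ h₂ => ?_
  simp only [appendTuple]
  split_ifs <;> first | rfl | omega | (congr 2; omega)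

theorem mrg_assoc (u v w : T.U) : T.mrg (T.mrg u v) w = T.mrg u (T.mrg v w) := by
  refine assoc_of_tau (fun m x n y l z => ?_) u v w
  simp only [T.mrg_eq]
  refine tau_congr (by omega) fun i h₁ h₂ => ?_
  obtain rfl | hm := Nat.eq_zero_or_pos m <;> obtain rfl | hn := Nat.eq_zero_or_pos n <;>
  simp only [mergeTuple, Fin.val_last, Fin.val_zero] <;>
  split_ifs <;> first
    | rfl
    | omega
    | (simp [mul_assoc, *]; done)
    | (congr 2; omega)
    | (congr 2; ext; simp)

theorem mrg_conc (u v w : T.U) : T.conc (T.mrg u v) w = T.mrg u (T.conc v w) := by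
  refine assoc_of_tau (fun m x n y l z => ?_) u v w
  simp only [T.mrg_eq, T.conc_eq]
  refine tau_congr (by omega) fun i h₁ h₂ => ?_
  simp only [mergeTuple, appendTuple, Fin.val_zero]
  split_ifs <;> first | rfl | omega | (congr 2; omega)

theorem conc_mrg (u v w : T.U) : T.mrg (T.conc u v) w = T.conc u (T.mrg v w) := by
  refine assoc_of_tau (fun m x n y l z => ?_) u v w
  simp only [T.mrg_eq, T.conc_eq]
  refine tau_congr (by omega) fun i h₁ h₂ => ?_
  simp only [mergeTuple, appendTuple, Fin.val_last]
  split_ifs <;> first | rfl | omega | (congr 2; omega) | (congr 2; ext; simp)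

theorem tau_succ_eq_iota_conc {N : ℕ} (x : Fin (N + 2) → A) :
    T.τ (N + 1) x = T.conc (T.ι (x 0)) (T.τ N (Fin.tail x)) := by
  rw [ι, T.conc_eq]
  refine tau_congr (by omega) fun i h₁ h₂ => ?_
  simp only [appendTuple, Fin.tail]
  split_ifs
  · congr 1; ext; simp; omega
  · congr 1; ext; simp; omega

theorem tau_succ_eq_conc_iota {N : ℕ} (x : Fin (N + 2) → A) :
    T.τ (N + 1) x = T.conc (T.τ N (Fin.init x)) (T.ι (x (Fin.last (N + 1)))) := by
  rw [ι, T.conc_eq]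
  refine tau_congr (by omega) fun i h₁ h₂ => ?_
  simp only [appendTuple, Fin.init]
  split_ifs
  · rfl
  · congr 1; ext; simp; omega

theorem tau_zero (x : Fin 1 → A) : T.τ 0 x = T.ι (x 0) :=
  congrArg _ (funext fun i => congrArg x (Subsingleton.elim i 0))

/-- Linear maps agreeing on all `x ⊗ w` with `x` of degree one agree in degrees `≥ 2`. -/
theorem eq_of_iota_conc {V : Type} [AddCommGroup V] [Module k V] {F G : T.U →ₗ[k] V}
    (hFG : ∀ x w, F (T.conc (T.ι x) w) = G (T.conc (T.ι x) w)) {n : ℕ} {u : T.U}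
    (hu : u ∈ T.Tdeg (n + 2)) : F u = G u := by
  refine LinearMap.eqOn_span (s := Set.range (T.τ (n + 1))) ?_ (Tdeg_succ_le_span _ hu)
  rintro _ ⟨x, rfl⟩
  rw [tau_succ_eq_iota_conc]
  exact hFG _ _

/-- Linear maps agreeing on all `w ⊗ x` with `x` of degree one agree in degrees `≥ 2`. -/
theorem eq_of_conc_iota {V : Type} [AddCommGroup V] [Module k V] {F G : T.U →ₗ[k] V}
    (hFG : ∀ x w, F (T.conc w (T.ι x)) = G (T.conc w (T.ι x))) {n : ℕ} {u : T.U}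
    (hu : u ∈ T.Tdeg (n + 2)) : F u = G u := by
  refine LinearMap.eqOn_span (s := Set.range (T.τ (n + 1))) ?_ (Tdeg_succ_le_span _ hu)
  rintro _ ⟨x, rfl⟩
  rw [tau_succ_eq_conc_iota]
  exact hFG _ _

theorem headIns_iota {p : ℕ} (f : MultilinearMap k (fun _ : Fin (p + 1) => A) T.U)
    (v : Fin p → A) (x : A) : T.headIns f v (T.ι x) = f (Fin.snoc v x) :=
  T.headIns_eq_one f v _

theorem tailIns_iota {p : ℕ} (f : MultilinearMap k (fun _ : Fin (p + 1) => A) T.U)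
    (v : Fin p → A) (x : A) : T.tailIns f v (T.ι x) = f (Fin.cons x v) :=
  T.tailIns_eq_one f v _

theorem headIns_iota_conc {p : ℕ} (f : MultilinearMap k (fun _ : Fin (p + 1) => A) T.U)
    (v : Fin p → A) (x : A) (w : T.U) :
    T.headIns f v (T.conc (T.ι x) w) = T.conc (f (Fin.snoc v x)) w := by
  refine eq_of_tau (F := (T.headIns f v).comp (T.conc (T.ι x))) (fun N y => ?_) w
  have := tau_succ_eq_iota_conc (T := T) (Fin.cons x y : Fin (N + 2) → A)
  rw [Fin.cons_zero, Fin.tail_cons] at this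
  rw [LinearMap.comp_apply, ← this, T.headIns_eq, Fin.cons_zero, Fin.tail_cons]

theorem tailIns_conc_iota {p : ℕ} (f : MultilinearMap k (fun _ : Fin (p + 1) => A) T.U)
    (v : Fin p → A) (x : A) (w : T.U) :
    T.tailIns f v (T.conc w (T.ι x)) = T.conc w (f (Fin.cons x v)) := by
  refine eq_of_tau (F := (T.tailIns f v).comp (T.conc.flip (T.ι x)))
    (G := T.conc.flip (f (Fin.cons x v))) (fun N y => ?_) w
  have := tau_succ_eq_conc_iota (T := T) (Fin.snoc y x : Fin (N + 2) → A)
  rw [Fin.snoc_last, Fin.init_snoc] at this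
  rw [LinearMap.comp_apply, LinearMap.flip_apply, ← this, T.tailIns_eq, Fin.snoc_last,
    Fin.init_snoc, LinearMap.flip_apply]

theorem headIns_conc {p : ℕ} (f : MultilinearMap k (fun _ : Fin (p + 1) => A) T.U)
    (v : Fin p → A) (u w : T.U) :
    T.headIns f v (T.conc u w) = T.conc (T.headIns f v u) w := by
  refine eq_of_tau (F := (T.headIns f v).comp (T.conc.flip w))
    (G := (T.conc.flip w).comp (T.headIns f v)) (fun N y => ?_) u
  simp only [LinearMap.comp_apply, LinearMap.flip_apply]
  cases N with
  | zero => rw [tau_zero, headIns_iota_conc, headIns_iota]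
  | succ N =>
    rw [tau_succ_eq_iota_conc, conc_assoc, headIns_iota_conc, headIns_iota_conc, conc_assoc]

theorem tailIns_conc {p : ℕ} (f : MultilinearMap k (fun _ : Fin (p + 1) => A) T.U)
    (v : Fin p → A) (u w : T.U) :
    T.tailIns f v (T.conc u w) = T.conc u (T.tailIns f v w) := by
  refine eq_of_tau (F := (T.tailIns f v).comp (T.conc u))
    (G := (T.conc u).comp (T.tailIns f v)) (fun N y => ?_) w
  simp only [LinearMap.comp_apply]
  cases N with
  | zero => rw [tau_zero, tailIns_conc_iota, tailIns_iota]
  | succ N =>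
    rw [tau_succ_eq_conc_iota, ← conc_assoc, tailIns_conc_iota, tailIns_conc_iota, conc_assoc]

theorem headIns_mrg {p n : ℕ} (f : MultilinearMap k (fun _ : Fin (p + 1) => A) T.U)
    (v : Fin p → A) {u : T.U} (hu : u ∈ T.Tdeg (n + 2)) (w : T.U) :
    T.headIns f v (T.mrg u w) = T.mrg (T.headIns f v u) w := by
  refine eq_of_iota_conc (F := (T.headIns f v).comp (T.mrg.flip w))
    (G := (T.mrg.flip w).comp (T.headIns f v)) (fun x z => ?_) hu
  simp only [LinearMap.comp_apply, LinearMap.flip_apply]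
  rw [conc_mrg, headIns_iota_conc, headIns_iota_conc, conc_mrg]

theorem tailIns_mrg {p n : ℕ} (f : MultilinearMap k (fun _ : Fin (p + 1) => A) T.U)
    (v : Fin p → A) (u : T.U) {w : T.U} (hw : w ∈ T.Tdeg (n + 2)) :
    T.tailIns f v (T.mrg u w) = T.mrg u (T.tailIns f v w) := by
  refine eq_of_conc_iota (F := (T.tailIns f v).comp (T.mrg u))
    (G := (T.mrg u).comp (T.tailIns f v)) (fun x z => ?_) hw
  simp only [LinearMap.comp_apply]
  rw [← mrg_conc, tailIns_conc_iota, tailIns_conc_iota, mrg_conc]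

theorem headIns_tailIns {p q n : ℕ} (f : MultilinearMap k (fun _ : Fin (p + 1) => A) T.U)
    (v : Fin p → A) (g : MultilinearMap k (fun _ : Fin (q + 1) => A) T.U)
    (w : Fin q → A) {u : T.U} (hu : u ∈ T.Tdeg (n + 2)) :
    T.headIns f v (T.tailIns g w u) = T.tailIns g w (T.headIns f v u) := by
  refine eq_of_iota_conc (F := (T.headIns f v).comp (T.tailIns g w))
    (G := (T.tailIns g w).comp (T.headIns f v)) (fun x z => ?_) hu
  simp only [LinearMap.comp_apply]
  rw [tailIns_conc, headIns_iota_conc, headIns_iota_conc, tailIns_conc]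

theorem exists_eq_sum_iota_conc {n : ℕ} {u : T.U} (hu : u ∈ T.Tdeg (n + 2)) :
    ∃ (N : ℕ) (x : Fin N → A) (w : Fin N → T.U), u = ∑ i, T.conc (T.ι (x i)) (w i) := by
  obtain ⟨N, c, y, rfl⟩ := Submodule.mem_span_set'.mp (Tdeg_succ_le_span _ hu)
  choose x hx using fun i => (y i).2
  refine ⟨N, fun i => x i 0, fun i => c i • T.τ n (Fin.tail (x i)),
    Finset.sum_congr rfl fun i _ => ?_⟩
  rw [map_smul, ← tau_succ_eq_iota_conc, hx]

theorem exists_eq_sum_conc_iota {n : ℕ} {u : T.U} (hu : u ∈ T.Tdeg (n + 2)) :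
    ∃ (N : ℕ) (x : Fin N → A) (w : Fin N → T.U), u = ∑ i, T.conc (w i) (T.ι (x i)) := by
  obtain ⟨N, c, y, rfl⟩ := Submodule.mem_span_set'.mp (Tdeg_succ_le_span _ hu)
  choose x hx using fun i => (y i).2
  refine ⟨N, fun i => x i (Fin.last _), fun i => c i • T.τ n (Fin.init (x i)),
    Finset.sum_congr rfl fun i _ => ?_⟩
  rw [map_smul, LinearMap.smul_apply, ← tau_succ_eq_conc_iota, hx]

theorem snoc_mk {B : Type} {n : ℕ} (v : Fin n → B) (x : B) (i : ℕ) (hi : i < n + 1) :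
    (Fin.snoc v x : Fin (n + 1) → B) ⟨i, hi⟩ = if h : i < n then v ⟨i, h⟩ else x := by
  simp [Fin.snoc]

theorem cons_mk {B : Type} {n : ℕ} (v : Fin n → B) (x : B) (i : ℕ) (hi : i < n + 1) :
    (Fin.cons x v : Fin (n + 1) → B) ⟨i, hi⟩ =
      if h : i = 0 then x else v ⟨i - 1, by omega⟩ := by
  cases i <;> rfl

theorem headIns_vdash {p q n : ℕ} (f : MultilinearMap k (fun _ : Fin (p + 2) => A) T.U)
    (g : MultilinearMap k (fun _ : Fin (q + 2) => A) T.U) (v : Fin (p + q + 2) → A)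
    {u : T.U} (hu : u ∈ T.Tdeg (n + 2)) :
    T.headIns (T.vdash f g) v u =
      T.headIns f (fun i : Fin (p + 1) => v ⟨i.1, by omega⟩)
        (T.headIns g (fun j : Fin (q + 1) => v ⟨p + 1 + j.1, by omega⟩) u) := by
  refine eq_of_iota_conc (F := T.headIns (T.vdash f g) v)
    (G := (T.headIns f _).comp (T.headIns g _)) (fun x w => ?_) hu
  rw [LinearMap.comp_apply, headIns_iota_conc, T.vdash_eq, headIns_iota_conc, headIns_conc]
  refine congrArg₂ (fun s t => T.conc (T.headIns f s (g t)) w)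
    (funext fun ⟨i, hi⟩ => ?_) (funext fun ⟨i, hi⟩ => ?_) <;>
  simp only [snoc_mk] <;>
  split_ifs <;> first | rfl | omega

theorem tailIns_dashv {p q n : ℕ} (f : MultilinearMap k (fun _ : Fin (p + 2) => A) T.U)
    (g : MultilinearMap k (fun _ : Fin (q + 2) => A) T.U) (v : Fin (p + q + 2) → A)
    {u : T.U} (hu : u ∈ T.Tdeg (n + 2)) :
    T.tailIns (T.dashv f g) v u =
      T.tailIns g (fun j : Fin (q + 1) => v ⟨p + 1 + j.1, by omega⟩)
        (T.tailIns f (fun i : Fin (p + 1) => v ⟨i.1, by omega⟩) u) := by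
  refine eq_of_conc_iota (F := T.tailIns (T.dashv f g) v)
    (G := (T.tailIns g _).comp (T.tailIns f _)) (fun x w => ?_) hu
  rw [LinearMap.comp_apply, tailIns_conc_iota, T.dashv_eq, tailIns_conc_iota, tailIns_conc]
  refine congrArg₂ (fun s t => T.conc w (T.tailIns g s (f t)))
    (funext fun ⟨i, hi⟩ => ?_) (funext fun ⟨i, hi⟩ => ?_) <;>
  simp only [cons_mk] <;>
  split_ifs <;> first | rfl | omega | (congr 2; omega)

theorem headIns_cup {p q n : ℕ} (f : MultilinearMap k (fun _ : Fin (p + 1) => A) T.U)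
    (g : MultilinearMap k (fun _ : Fin (q + 1) => A) T.U) (v : Fin (p + q + 1) → A)
    {u : T.U} (hu : u ∈ T.Tdeg (n + 2)) :
    T.headIns (T.cup f g) v u =
      T.mrg (f fun i : Fin (p + 1) => v ⟨i.1, by omega⟩)
        (T.headIns g (fun j : Fin q => v ⟨p + 1 + j.1, by omega⟩) u) := by
  refine eq_of_iota_conc (F := T.headIns (T.cup f g) v)
    (G := (T.mrg _).comp (T.headIns g _)) (fun x w => ?_) hu
  rw [LinearMap.comp_apply, headIns_iota_conc, T.cup_eq, headIns_iota_conc, mrg_conc]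
  refine congrArg₂ (fun s t => T.mrg (f s) (T.conc (g t) w))
    (funext fun ⟨i, hi⟩ => ?_) (funext fun ⟨i, hi⟩ => ?_) <;>
  simp only [snoc_mk] <;>
  split_ifs <;> first | rfl | omega

theorem tailIns_cup {p q n : ℕ} (f : MultilinearMap k (fun _ : Fin (p + 1) => A) T.U)
    (g : MultilinearMap k (fun _ : Fin (q + 1) => A) T.U) (v : Fin (p + q + 1) → A)
    {u : T.U} (hu : u ∈ T.Tdeg (n + 2)) :
    T.tailIns (T.cup f g) v u =
      T.mrg (T.tailIns f (fun i : Fin p => v ⟨i.1, by omega⟩) u)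
        (g fun j : Fin (q + 1) => v ⟨p + j.1, by omega⟩) := by
  refine eq_of_conc_iota (F := T.tailIns (T.cup f g) v)
    (G := (T.mrg.flip _).comp (T.tailIns f _)) (fun x w => ?_) hu
  rw [LinearMap.comp_apply, LinearMap.flip_apply, tailIns_conc_iota, T.cup_eq,
    tailIns_conc_iota, conc_mrg]
  refine congrArg₂ (fun s t => T.conc w (T.mrg (f s) (g t)))
    (funext fun ⟨i, hi⟩ => ?_) (funext fun ⟨i, hi⟩ => ?_) <;>
  simp only [cons_mk] <;>
  split_ifs <;> first | rfl | omega | (congr 2; omega)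

theorem tailIns_vdash_conc_iota {p q : ℕ}
    (f : MultilinearMap k (fun _ : Fin (p + 2) => A) T.U)
    (g : MultilinearMap k (fun _ : Fin (q + 2) => A) T.U) (v : Fin (p + q + 2) → A)
    (x : A) (w : T.U) :
    T.tailIns (T.vdash f g) v (T.conc w (T.ι x)) =
      T.conc w (T.headIns f (Fin.cons x fun i : Fin p => v ⟨i.1, by omega⟩)
        (g fun j : Fin (q + 2) => v ⟨p + j.1, by omega⟩)) := by
  rw [tailIns_conc_iota, T.vdash_eq]
  refine congrArg₂ (fun s t => T.conc w (T.headIns f s (g t)))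
    (funext fun ⟨i, hi⟩ => ?_) (funext fun ⟨i, hi⟩ => ?_) <;>
  simp only [cons_mk] <;>
  split_ifs <;> first | rfl | omega | (congr 2; omega)

theorem headIns_dashv_iota_conc {p q : ℕ}
    (f : MultilinearMap k (fun _ : Fin (p + 2) => A) T.U)
    (g : MultilinearMap k (fun _ : Fin (q + 2) => A) T.U) (v : Fin (p + q + 2) → A)
    (x : A) (w : T.U) :
    T.headIns (T.dashv f g) v (T.conc (T.ι x) w) =
      T.conc (T.tailIns g (Fin.snoc (fun i : Fin q => v ⟨p + 2 + i.1, by omega⟩) x)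
        (f fun j : Fin (p + 2) => v ⟨j.1, by omega⟩)) w := by
  rw [headIns_iota_conc, T.dashv_eq]
  refine congrArg₂ (fun s t => T.conc (T.tailIns g s (f t)) w)
    (funext fun ⟨i, hi⟩ => ?_) (funext fun ⟨i, hi⟩ => ?_) <;>
  simp only [snoc_mk] <;>
  split_ifs <;> first | rfl | omega

/-- Feeding the last component of `u` and the first component of `w` to `g` can be done in
either order. -/
theorem insertion_comm {q m n : ℕ} (g : MultilinearMap k (fun _ : Fin (q + 2) => A) T.U)
    (v : Fin q → A) {u w : T.U} (hu : u ∈ T.Tdeg (m + 2)) (hw : w ∈ T.Tdeg (n + 2))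
    {F G : T.U →ₗ[k] T.U}
    (hF : ∀ x z, F (T.conc z (T.ι x)) = T.conc z (T.headIns g (Fin.cons x v) w))
    (hG : ∀ x z, G (T.conc (T.ι x) z) = T.conc (T.tailIns g (Fin.snoc v x) u) z) :
    F u = G w := by
  obtain ⟨M, x, z, rfl⟩ := exists_eq_sum_conc_iota hu
  obtain ⟨N, y, t, rfl⟩ := exists_eq_sum_iota_conc hw
  simp only [map_sum, hF, hG, headIns_iota_conc, tailIns_conc_iota, LinearMap.sum_apply,
    conc_assoc, Fin.cons_snoc_eq_snoc_cons]
  exact Finset.sum_comm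

end TensorTower

/-- For all `f ∈ C^p(A, A^{⊗k})`, `g ∈ C^q(A, A^{⊗m})`,
`h ∈ C^r(A, A^{⊗l})` with `p, q, r ≥ 2` and `k, m, l ≥ 2` (realized with `p ↦ p+2`,
`k ↦ kk+2`, etc.), the three operations `⊢, ⊣, ∪` are pairwise mutually associative:
`f ⋆ (g ⋆' h) = (f ⋆ g) ⋆' h` for every choice of `⋆, ⋆' ∈ {⊢, ⊣, ∪}`. -/
theorem mutual_associativity
    {k A : Type} [Field k] [CharZero k] [Ring A] [Algebra k A]
    (T : TensorTower k A) (p q r kk mm ll : ℕ)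
    (f : MultilinearMap k (fun _ : Fin (p + 2) => A) T.U)
    (g : MultilinearMap k (fun _ : Fin (q + 2) => A) T.U)
    (h : MultilinearMap k (fun _ : Fin (r + 2) => A) T.U)
    (hf : ∀ x, f x ∈ T.Tdeg (kk + 2))
    (hg : ∀ x, g x ∈ T.Tdeg (mm + 2))
    (hh : ∀ x, h x ∈ T.Tdeg (ll + 2)) :
    (∀ a, T.vdash f (T.vdash g h) a
        = T.vdash (T.vdash f g) h (fun i => a (Fin.cast (by omega) i)))
    ∧ (∀ a, T.vdash f (T.dashv g h) a
        = T.dashv (T.vdash f g) h (fun i => a (Fin.cast (by omega) i)))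
    ∧ (∀ a, T.vdash f (T.cup g h) a
        = T.cup (T.vdash f g) h (fun i => a (Fin.cast (by omega) i)))
    ∧ (∀ a, T.dashv f (T.vdash g h) a
        = T.vdash (T.dashv f g) h (fun i => a (Fin.cast (by omega) i)))
    ∧ (∀ a, T.dashv f (T.dashv g h) a
        = T.dashv (T.dashv f g) h (fun i => a (Fin.cast (by omega) i)))
    ∧ (∀ a, T.dashv f (T.cup g h) a
        = T.cup (T.dashv f g) h (fun i => a (Fin.cast (by omega) i)))
    ∧ (∀ a, T.cup f (T.vdash g h) a
        = T.vdash (T.cup f g) h (fun i => a (Fin.cast (by omega) i)))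
    ∧ (∀ a, T.cup f (T.dashv g h) a
        = T.dashv (T.cup f g) h (fun i => a (Fin.cast (by omega) i)))
    ∧ (∀ a, T.cup f (T.cup g h) a
        = T.cup (T.cup f g) h (fun i => a (Fin.cast (by omega) i))) := by
  refine ⟨fun a => ?_, fun a => ?_, fun a => ?_, fun a => ?_, fun a => ?_, fun a => ?_,
    fun a => ?_, fun a => ?_, fun a => ?_⟩
  · simp only [T.vdash_eq]
    rw [TensorTower.headIns_vdash _ _ _ (hh _)]
    simp only [Fin.cast_mk]
    congr! 5
    all_goals (simp only [Fin.mk.injEq]; omega)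
  · simp only [T.vdash_eq, T.dashv_eq]
    rw [TensorTower.headIns_tailIns _ _ _ _ (hg _)]
    simp only [Fin.cast_mk]
    congr! 5
    all_goals omega
  · simp only [T.vdash_eq, T.cup_eq]
    rw [TensorTower.headIns_mrg _ _ (hg _)]
    simp only [Fin.cast_mk]
    congr! 5
    all_goals omega
  · rw [T.dashv_eq, T.vdash_eq]
    refine TensorTower.insertion_comm g (fun i => a ⟨p + 2 + i.1, by omega⟩) (hf _) (hh _)
      (fun x z => ?_) (fun x z => ?_)
    · rw [TensorTower.tailIns_vdash_conc_iota]
      simp only [Fin.cast_mk]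
      congr! 5
      all_goals (simp only [Fin.mk.injEq]; omega)
    · rw [TensorTower.headIns_dashv_iota_conc]
      simp only [Fin.cast_mk]
  · simp only [T.dashv_eq]
    rw [TensorTower.tailIns_dashv _ _ _ (hf _)]
    simp only [Fin.cast_mk]
    congr! 5
    all_goals omega
  · simp only [T.dashv_eq, T.cup_eq]
    rw [TensorTower.tailIns_cup _ _ _ (hf _)]
    simp only [Fin.cast_mk]
    congr! 5
    all_goals omega
  · simp only [T.vdash_eq, T.cup_eq]
    rw [TensorTower.headIns_cup _ _ _ (hh _)]
    simp only [Fin.cast_mk]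
    congr! 5
    all_goals (simp only [Fin.mk.injEq]; omega)
  · simp only [T.dashv_eq, T.cup_eq]
    rw [TensorTower.tailIns_mrg _ _ _ (hg _)]
    simp only [Fin.cast_mk]
    congr! 5
    all_goals (simp only [Fin.mk.injEq]; omega)
  · simp only [T.cup_eq]
    rw [TensorTower.mrg_assoc]
    simp only [Fin.cast_mk]
    congr! 5
    all_goals (simp only [Fin.mk.injEq]; omega)
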